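/- arXiv:1508.00827 — 2 statements merged into one kernel-verified Lean document; each statement's English description precedes it below -/
import Mathlib

section
/- Let K ≥ 1. There exists C = C(K) > 0 such that the following holds. Let φ̂ : ℤ → ℂ be finitely supported with M := Σ_{n∈ℤ} |φ̂(n)|, let φ(x) = Σ_n φ̂(n) e^{inx}, and let w_n(t) = (1/2π) ∫₀^{2π} φ(x) e^{i|φ(x)|² t} e^{−inx} dx. Let 0 < T satisfy T M² ≤ 1, and let a : ℤ → [0,T] → ℂ satisfy the Duhamel system with data φ̂, i.e. a_n(t) = φ̂(n) + i ∫₀^t Σ_{(n₁,n₂,n₃)∈Γ(n)} e^{−iΦ(n̄)t'} a_{n₁}(t') \overline{a_{n₂}(t')} a_{n₃}(t') dt' for all n and t ∈ [0,T], together with the a priori bounds sup_{t∈[0,T]} Σ_n |a_n(t)| ≤ K M and sup_{t∈[0,T]} sup_n |a_n(t)| ≤ K sup_n |φ̂(n)|. Then sup_{t∈[0,T]} sup_{n∈ℤ} |w_n(t) − a_n(t)| ≤ C ( sup_{t∈[0,T]} sup_{n∈ℤ} | Σ_{(n₁,n₂,n₃)∈Γ(n)} (∫₀^t (1 − e^{−iΦ(n̄)t'})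 dt') φ̂(n₁) \overline{φ̂(n₂)} φ̂(n₃) | + Σ_{k=2}^{4} T^k M^{2k} sup_{n∈ℤ} |φ̂(n)| ). -/
open scoped Real

/-- `φ(x) = Σ_n φ̂(n) e^{inx}`. -/
noncomputable def phiOf (φhat : ℤ → ℂ) (x : ℝ) : ℂ :=
  ∑' n : ℤ, φhat n * Complex.exp (Complex.I * (n : ℂ) * (x : ℂ))

/-- Fourier coefficients of the solution `φ e^{i|φ|²t}` of the dispersionless
ODE: `w_n(t) = (1/2π) ∫₀^{2π} φ(x) e^{i|φ(x)|²t} e^{−inx} dx`. -/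
noncomputable def wCoeff (φhat : ℤ → ℂ) (n : ℤ) (t : ℝ) : ℂ :=
  (1 / (2 * (π : ℂ))) *
    ∫ x in (0:ℝ)..(2*π),
      phiOf φhat x * Complex.exp (Complex.I * ((‖phiOf φhat x‖^2 : ℝ) : ℂ) * (t : ℂ)) *
        Complex.exp (-Complex.I * (n : ℂ) * (x : ℂ))


/-- The index set `Γ(n)`. -/
abbrev Gam (n : ℤ) := {p : ℤ × ℤ × ℤ // n = p.1 - p.2.1 + p.2.2}

lemma gam_inj12 (n : ℤ) : Function.Injective (fun p : Gam n => (p.1.1, p.1.2.1)) := by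
  rintro ⟨⟨a, b, c⟩, h⟩ ⟨⟨a', b', c'⟩, h'⟩ hh
  dsimp only at h h'
  simp only [Prod.mk.injEq, Subtype.mk.injEq] at hh ⊢
  omega

lemma gam_inj13 (n : ℤ) : Function.Injective (fun p : Gam n => (p.1.1, p.1.2.2)) := by
  rintro ⟨⟨a, b, c⟩, h⟩ ⟨⟨a', b', c'⟩, h'⟩ hh
  dsimp only at h h'
  simp only [Prod.mk.injEq, Subtype.mk.injEq] at hh ⊢
  omega

lemma gam_inj23 (n : ℤ) : Function.Injective (fun p : Gam n => (p.1.2.1, p.1.2.2)) := by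
  rintro ⟨⟨a, b, c⟩, h⟩ ⟨⟨a', b', c'⟩, h'⟩ hh
  dsimp only at h h'
  simp only [Prod.mk.injEq, Subtype.mk.injEq] at hh ⊢
  omega

lemma tri_bound {n : ℤ} (e : Gam n → ℤ × ℤ) (he : Function.Injective e) (F : Gam n → ℂ)
    (g h : ℤ → ℝ) (hg0 : ∀ m, 0 ≤ g m) (hh0 : ∀ m, 0 ≤ h m) (hg : Summable g) (hh : Summable h)
    (A : ℝ) (hA : 0 ≤ A) (hF : ∀ p, ‖F p‖ ≤ A * (g (e p).1 * h (e p).2)) :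
    Summable F ∧ ‖∑' p, F p‖ ≤ A * ((∑' m, g m) * ∑' m, h m) := by
  have h1 : Summable (fun q : ℤ × ℤ => g q.1 * h q.2) :=
    hg.mul_of_nonneg hh hg0 hh0
  have h2 : Summable (fun p : Gam n => g (e p).1 * h (e p).2) := h1.comp_injective he
  have h3 : Summable (fun p : Gam n => A * (g (e p).1 * h (e p).2)) := h2.mul_left A
  refine ⟨Summable.of_norm_bounded h3 hF, ?_⟩
  calc ‖∑' p, F p‖ ≤ ∑' p, A * (g (e p).1 * h (e p).2) :=
        tsum_of_norm_bounded h3.hasSum hF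
    _ = A * ∑' p, (g (e p).1 * h (e p).2) := tsum_mul_left
    _ ≤ A * ((∑' m, g m) * ∑' m, h m) := by
        refine mul_le_mul_of_nonneg_left ?_ hA
        have h5 : (∑' m, g m) * ∑' m, h m = ∑' q : ℤ × ℤ, g q.1 * h q.2 :=
          hg.tsum_mul_tsum hh h1
        rw [h5]
        exact tsum_comp_le_tsum_of_inj h1 (fun q => mul_nonneg (hg0 _) (hh0 _)) he

lemma norm_osc (k : ℤ) (t : ℝ) : ‖Complex.exp (-Complex.I * (k : ℂ) * (t : ℂ))‖ = 1 := by
  have : -Complex.I * (k : ℂ) * (t : ℂ) = ((-(k:ℝ) * t : ℝ) : ℂ) * Complex.I := by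
    push_cast; ring
  rw [this, Complex.norm_exp_ofReal_mul_I]

lemma norm_osc' (k : ℤ) (t : ℝ) : ‖Complex.exp (Complex.I * (k : ℂ) * (t : ℂ))‖ = 1 := by
  have : Complex.I * (k : ℂ) * (t : ℂ) = (((k:ℝ) * t : ℝ) : ℂ) * Complex.I := by
    push_cast; ring
  rw [this, Complex.norm_exp_ofReal_mul_I]

/-- A primitive (with junk value) of a bounded function is a.e. measurable. -/
lemma aemeas_prim (T B : ℝ) (F : ℝ → ℂ) (hF : ∀ t ∈ Set.Icc (0:ℝ) T, ‖F t‖ ≤ B) :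
    AEMeasurable (fun t => ∫ s in (0:ℝ)..t, F s) (MeasureTheory.volume.restrict (Set.Icc 0 T)) := by
  set A : Set ℝ := {t | t ∈ Set.Icc (0:ℝ) T ∧ IntervalIntegrable F MeasureTheory.volume 0 t} with hA
  have hAo : A.OrdConnected := by
    refine ⟨?_⟩
    rintro x ⟨hx, hx'⟩ y ⟨hy, hy'⟩ z hz
    refine ⟨⟨hx.1.trans hz.1, hz.2.trans hy.2⟩, ?_⟩
    refine hy'.mono_set ?_
    rw [Set.uIcc_of_le (hx.1.trans hz.1), Set.uIcc_of_le hy.1]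
    exact Set.Icc_subset_Icc le_rfl hz.2
  have hAm : MeasurableSet A := hAo.measurableSet
  have hcont : ContinuousOn (fun t => ∫ s in (0:ℝ)..t, F s) A := by
    have hL : LipschitzOnWith (Real.toNNReal B) (fun t => ∫ s in (0:ℝ)..t, F s) A := by
      refine LipschitzOnWith.of_dist_le_mul ?_
      rintro x ⟨hx, hx'⟩ y ⟨hy, hy'⟩
      rw [dist_eq_norm, intervalIntegral.integral_interval_sub_left hx' hy', Real.dist_eq]
      refine intervalIntegral.norm_integral_le_of_norm_le_const ?_
      intro s hs
      refine (hF s ?_).trans (Real.le_coe_toNNReal B)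
      have := Set.uIoc_subset_uIcc hs
      rw [Set.mem_uIcc] at this
      rcases this with h | h
      · exact ⟨hy.1.trans h.1, h.2.trans hx.2⟩
      · exact ⟨hx.1.trans h.1, h.2.trans hy.2⟩
    exact hL.continuousOn
  have h1 : AEMeasurable (fun t => ∫ s in (0:ℝ)..t, F s) (MeasureTheory.volume.restrict A) :=
    hcont.aemeasurable hAm
  have h2 : AEMeasurable (fun t => ∫ s in (0:ℝ)..t, F s)
      (MeasureTheory.volume.restrict (Set.Icc 0 T \ A)) := by
    refine AEMeasurable.congr (f := fun _ => (0:ℂ)) aemeasurable_const ?_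
    filter_upwards [MeasureTheory.ae_restrict_mem (measurableSet_Icc.diff hAm)] with t ht
    rw [intervalIntegral.integral_undef]
    intro h
    exact ht.2 ⟨ht.1, h⟩
  have h3 := aemeasurable_union_iff.2 ⟨h1, h2⟩
  refine h3.mono_measure (MeasureTheory.Measure.restrict_mono ?_ le_rfl)
  intro t ht
  by_cases h : t ∈ A
  · exact Or.inl h
  · exact Or.inr ⟨ht, h⟩

lemma aemeas_tsum {ι : Type*} [Countable ι] (μ : MeasureTheory.Measure ℝ) (f : ι → ℝ → ℂ)
    (hf : ∀ i, AEMeasurable (f i) μ) (hs : ∀ᵐ t ∂μ, Summable (fun i => f i t)) :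
    AEMeasurable (fun t => ∑' i, f i t) μ := by
  refine aemeasurable_of_tendsto_metrizable_ae (u := Filter.atTop)
    (f := fun (s : Finset ι) t => ∑ i ∈ s, f i t) ?_ ?_
  · intro s
    exact Finset.aemeasurable_fun_sum s (fun i _ => hf i)
  · filter_upwards [hs] with t ht
    exact ht.hasSum

/-- Finite reduction of cubic sums. -/
lemma gam_fin (φ : ℤ → ℂ) (hφ : (Function.support φ).Finite) (n : ℤ) :
    ∃ s : Finset (Gam n), ∀ p ∉ s,
      φ p.1.1 = 0 ∨ φ p.1.2.1 = 0 := by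
  have h : (((fun p : Gam n => (p.1.1, p.1.2.1))) ⁻¹'
      (Function.support φ ×ˢ Function.support φ)).Finite :=
    (hφ.prod hφ).preimage (gam_inj12 n).injOn
  refine ⟨h.toFinset, fun p hp => ?_⟩
  by_contra hc
  push Not at hc
  apply hp
  simp [hc]

/-- Coefficient functional. -/
noncomputable def coefL (n : ℤ) (g : ℝ → ℂ) : ℂ :=
  (1 / (2 * (π : ℂ))) * ∫ x in (0:ℝ)..(2*π), g x * Complex.exp (-Complex.I * (n : ℂ) * (x : ℂ))

lemma phiOf_eq_sum (φ : ℤ → ℂ) (s : Finset ℤ) (hs : ∀ m ∉ s, φ m = 0) (x : ℝ) :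
    phiOf φ x = ∑ m ∈ s, φ m * Complex.exp (Complex.I * (m : ℂ) * (x : ℂ)) := by
  unfold phiOf
  exact tsum_eq_sum (fun m hm => by simp [hs m hm])

lemma phiOf_cont (φ : ℤ → ℂ) (hφ : (Function.support φ).Finite) : Continuous (phiOf φ) := by
  have : phiOf φ = fun x : ℝ => ∑ m ∈ hφ.toFinset, φ m * Complex.exp (Complex.I * (m : ℂ) * (x : ℂ)) := by
    funext x
    exact phiOf_eq_sum φ _ (fun m hm => by simpa using hm) x
  rw [this]
  fun_prop

lemma summable_of_finite_supp (φ : ℤ → ℂ) (hφ : (Function.support φ).Finite) :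
    Summable (fun m => ‖φ m‖) :=
  summable_of_ne_finset_zero (s := hφ.toFinset) (fun m hm => by simpa using hm)

lemma phiOf_norm (φ : ℤ → ℂ) (hφ : (Function.support φ).Finite) (x : ℝ) :
    ‖phiOf φ x‖ ≤ ∑' m, ‖φ m‖ := by
  have hs : Summable (fun m => ‖φ m‖) := summable_of_finite_supp φ hφ
  unfold phiOf
  refine tsum_of_norm_bounded hs.hasSum (fun m => ?_)
  rw [norm_mul, norm_osc', mul_one]

lemma coefL_sum (n : ℤ) (s : Finset ℤ) (c : ℤ → ℂ) (g : ℤ → ℝ → ℂ) (hg : ∀ m, Continuous (g m)) :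
    coefL n (fun x => ∑ m ∈ s, c m * g m x) = ∑ m ∈ s, c m * coefL n (g m) := by
  unfold coefL
  simp_rw [Finset.sum_mul]
  rw [intervalIntegral.integral_finsetSum]
  · rw [Finset.mul_sum]
    refine Finset.sum_congr rfl (fun m _ => ?_)
    simp_rw [mul_assoc]
    rw [intervalIntegral.integral_const_mul]
    ring
  · intro m _
    have := hg m
    exact Continuous.intervalIntegrable (by fun_prop) _ _

lemma coefL_shift (n m : ℤ) (g : ℝ → ℂ) :
    coefL n (fun x => Complex.exp (Complex.I * (m : ℂ) * (x : ℂ)) * g x) = coefL (n - m) g := by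
  unfold coefL
  congr 1
  refine intervalIntegral.integral_congr (fun x _ => ?_)
  have : Complex.exp (-Complex.I * ((n - m : ℤ) : ℂ) * (x : ℂ)) =
      Complex.exp (Complex.I * (m : ℂ) * (x : ℂ)) * Complex.exp (-Complex.I * (n : ℂ) * (x : ℂ)) := by
    rw [← Complex.exp_add]; congr 1; push_cast; ring
  simp only [this]
  ring

lemma coefL_phi_mul (φ : ℤ → ℂ) (s : Finset ℤ) (hs : ∀ m ∉ s, φ m = 0) (n : ℤ) (g : ℝ → ℂ)
    (hg : Continuous g) :
    coefL n (fun x => phiOf φ x * g x) = ∑ m ∈ s, φ m * coefL (n - m) g := by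
  have : (fun x => phiOf φ x * g x) = fun x : ℝ => ∑ m ∈ s, φ m *
      (fun (m : ℤ) (x : ℝ) => Complex.exp (Complex.I * (m : ℂ) * (x : ℂ)) * g x) m x := by
    funext x
    rw [phiOf_eq_sum φ s hs, Finset.sum_mul]
    simp only [mul_assoc]
  rw [this, coefL_sum]
  · simp only [coefL_shift]
  · intro m; fun_prop

lemma coefL_conj_mul (φ : ℤ → ℂ) (s : Finset ℤ) (hs : ∀ m ∉ s, φ m = 0) (n : ℤ) (g : ℝ → ℂ)
    (hg : Continuous g) :
    coefL n (fun x => (starRingEnd ℂ) (phiOf φ x) * g x) =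
      ∑ m ∈ s, (starRingEnd ℂ) (φ m) * coefL (n + m) g := by
  have : (fun x => (starRingEnd ℂ) (phiOf φ x) * g x) = fun x : ℝ => ∑ m ∈ s, (starRingEnd ℂ) (φ m) *
      (fun (m : ℤ) (x : ℝ) => Complex.exp (Complex.I * ((-m : ℤ) : ℂ) * (x : ℂ)) * g x) m x := by
    funext x
    rw [phiOf_eq_sum φ s hs, map_sum, Finset.sum_mul]
    refine Finset.sum_congr rfl (fun m _ => ?_)
    simp only [map_mul, ← Complex.exp_conj, Complex.conj_I, Complex.conj_ofReal, map_intCast]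
    have : -Complex.I * (m : ℂ) * (x : ℂ) = Complex.I * ((-m : ℤ) : ℂ) * (x : ℂ) := by
      push_cast; ring
    rw [this, mul_assoc]
  rw [this, coefL_sum]
  · simp only [coefL_shift, sub_neg_eq_add]
  · intro m; fun_prop

lemma coefL_one (n : ℤ) : coefL n (fun _ => 1) = if n = 0 then 1 else 0 := by
  unfold coefL
  have hpi : (π : ℂ) ≠ 0 := by exact_mod_cast Real.pi_ne_zero
  split_ifs with h
  · subst h
    simp
    field_simp
  · simp only [one_mul]
    have hc : -Complex.I * (n : ℂ) ≠ 0 := by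
      simp [h]
    rw [integral_exp_mul_complex hc]
    have : -Complex.I * (n : ℂ) * ((2 * π : ℝ) : ℂ) = ((-n : ℤ) : ℂ) * (2 * π * Complex.I) := by
      push_cast; ring
    rw [this, Complex.exp_int_mul_two_pi_mul_I]
    simp

lemma coefL_phi (φ : ℤ → ℂ) (s : Finset ℤ) (hs : ∀ m ∉ s, φ m = 0) (n : ℤ) :
    coefL n (phiOf φ) = φ n := by
  have := coefL_phi_mul φ s hs n (fun _ => 1) continuous_const
  simp only [mul_one, coefL_one] at this
  rw [show coefL n (phiOf φ) = coefL n (fun x => phiOf φ x) from rfl, this]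
  have : ∀ m, (n - m = 0) ↔ n = m := fun m => by omega
  simp only [this]
  by_cases hn : n ∈ s
  · simp [hn]
  · simp [hn, hs n hn]

/-- The functions `φ |φ|^{2k}`. -/
noncomputable def pk (φ : ℤ → ℂ) (k : ℕ) (x : ℝ) : ℂ :=
  phiOf φ x * ((‖phiOf φ x‖^2 : ℝ) : ℂ)^k

lemma pk_succ (φ : ℤ → ℂ) (k : ℕ) :
    pk φ (k+1) = fun x => phiOf φ x * ((starRingEnd ℂ) (phiOf φ x) * pk φ k x) := by
  funext x
  unfold pk
  have := Complex.mul_conj' (phiOf φ x)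
  rw [pow_succ]
  push_cast
  rw [← this]
  ring

lemma pk_cont (φ : ℤ → ℂ) (hφ : (Function.support φ).Finite) (k : ℕ) : Continuous (pk φ k) := by
  have := phiOf_cont φ hφ
  unfold pk
  fun_prop

lemma coefL_pk_succ (φ : ℤ → ℂ) (hφ : (Function.support φ).Finite) (k : ℕ) (n : ℤ) :
    coefL n (pk φ (k+1)) = ∑ m ∈ hφ.toFinset, φ m * ∑ l ∈ hφ.toFinset,
      (starRingEnd ℂ) (φ l) * coefL (n - m + l) (pk φ k) := by
  have hs : ∀ m ∉ hφ.toFinset, φ m = 0 := fun m hm => by simpa using hm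
  have h1 := pk_cont φ hφ k
  have h2 := phiOf_cont φ hφ
  rw [pk_succ, coefL_phi_mul φ _ hs n (fun x => (starRingEnd ℂ) (phiOf φ x) * pk φ k x)
    ((Complex.continuous_conj.comp h2).mul h1)]
  refine Finset.sum_congr rfl (fun m _ => ?_)
  rw [coefL_conj_mul φ _ hs _ _ h1]

lemma norm_sum_M (φ c : ℤ → ℂ) (hφ : (Function.support φ).Finite) (A : ℝ)
    (hc : ∀ m, ‖c m‖ ≤ A) (ψ : ℤ → ℂ) (hψ : ∀ m, ‖ψ m‖ = ‖φ m‖) :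
    ‖∑ m ∈ hφ.toFinset, ψ m * c m‖ ≤ (∑' m, ‖φ m‖) * A := by
  have h : (∑' m, ‖φ m‖) = ∑ m ∈ hφ.toFinset, ‖φ m‖ :=
    tsum_eq_sum (fun m hm => by simpa using hm)
  rw [h, Finset.sum_mul]
  refine norm_sum_le_of_le _ (fun m _ => ?_)
  rw [norm_mul, hψ]
  exact mul_le_mul_of_nonneg_left (hc m) (norm_nonneg _)

lemma coefL_pk_bound (φ : ℤ → ℂ) (hφ : (Function.support φ).Finite) (S : ℝ)
    (hS : ∀ m, ‖φ m‖ ≤ S) (k : ℕ) : ∀ n : ℤ,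
    ‖coefL n (pk φ k)‖ ≤ (∑' m, ‖φ m‖)^(2*k) * S := by
  have hs : ∀ m ∉ hφ.toFinset, φ m = 0 := fun m hm => by simpa using hm
  induction k with
  | zero =>
    intro n
    have : pk φ 0 = phiOf φ := by funext x; simp [pk]
    rw [this, coefL_phi φ _ hs]
    simpa using hS n
  | succ k ih =>
    intro n
    rw [coefL_pk_succ φ hφ]
    refine (norm_sum_M φ (fun m => ∑ l ∈ hφ.toFinset,
      (starRingEnd ℂ) (φ l) * coefL (n - m + l) (pk φ k)) hφ _ (fun m => ?_) φ (fun _ => rfl)).trans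
      (le_of_eq (?_ : _ * ((∑' m, ‖φ m‖) * ((∑' m, ‖φ m‖)^(2*k) * S)) = _))
    · exact norm_sum_M φ (fun l => coefL (n - m + l) (pk φ k)) hφ _ (fun l => ih _)
        (fun l => (starRingEnd ℂ) (φ l)) (fun l => by simp)
    · ring

/-- The equivalence of `Γ(n)` with `ℤ × ℤ`. -/
def gamEquiv (n : ℤ) : ℤ × ℤ ≃ Gam n where
  toFun q := ⟨(q.1, q.2, n - q.1 + q.2), by dsimp only; ring⟩
  invFun p := (p.1.1, p.1.2.1)
  left_inv q := rfl
  right_inv p := by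
    obtain ⟨⟨a, b, c⟩, h⟩ := p
    dsimp only at h
    simp only [Subtype.mk.injEq, Prod.mk.injEq, true_and]
    omega

lemma coefL_pk_one (φ : ℤ → ℂ) (hφ : (Function.support φ).Finite) (n : ℤ) :
    coefL n (pk φ 1) = ∑' p : Gam n, φ p.1.1 * (starRingEnd ℂ) (φ p.1.2.1) * φ p.1.2.2 := by
  have hs : ∀ m ∉ hφ.toFinset, φ m = 0 := fun m hm => by simpa using hm
  have h0 : pk φ 0 = phiOf φ := by funext x; simp [pk]
  rw [show (1:ℕ) = 0 + 1 from rfl, coefL_pk_succ φ hφ, h0]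
  rw [← (gamEquiv n).tsum_eq]
  rw [tsum_eq_sum (s := hφ.toFinset ×ˢ hφ.toFinset)]
  · rw [Finset.sum_product]
    refine Finset.sum_congr rfl (fun m _ => ?_)
    rw [Finset.mul_sum]
    refine Finset.sum_congr rfl (fun l _ => ?_)
    rw [coefL_phi φ _ hs]
    simp only [gamEquiv, Equiv.coe_fn_mk]
    ring
  · rintro ⟨m, l⟩ hml
    simp only [gamEquiv, Equiv.coe_fn_mk]
    rw [Finset.mem_product, not_and_or] at hml
    rcases hml with h | h
    · simp [hs _ h]
    · simp [hs _ h]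

lemma hasSum_fcongr {f g : ℕ → ℂ} {c : ℂ} (h : ∀ k, f k = g k) (hg : HasSum g c) :
    HasSum f c := by
  rw [funext h]; exact hg

lemma wCoeff_hasSum (φ : ℤ → ℂ) (hφ : (Function.support φ).Finite) (n : ℤ) (t : ℝ) :
    HasSum (fun k : ℕ => (Complex.I * t)^k / (k.factorial : ℂ) * coefL n (pk φ k))
      (wCoeff φ n t) := by
  set M := ∑' m, ‖φ m‖ with hM
  have hM0 : 0 ≤ M := tsum_nonneg (fun _ => norm_nonneg _)
  have h := intervalIntegral.hasSum_integral_of_dominated_convergence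
    (μ := MeasureTheory.volume) (a := 0) (b := 2 * π)
    (F := fun (k : ℕ) (x : ℝ) => (Complex.I * t)^k / (k.factorial : ℂ) * (pk φ k x *
      Complex.exp (-Complex.I * (n : ℂ) * (x : ℂ))))
    (f := fun x => phiOf φ x * Complex.exp (Complex.I * ((‖phiOf φ x‖^2 : ℝ) : ℂ) * (t : ℂ)) *
        Complex.exp (-Complex.I * (n : ℂ) * (x : ℂ)))
    (fun k _ => M * ((|t| * M^2)^k / (k.factorial : ℝ)))
    (fun k => by
      have := pk_cont φ hφ k
      exact Continuous.aestronglyMeasurable (by fun_prop))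
    (fun k => by
      refine Filter.Eventually.of_forall (fun x _ => ?_)
      have hb := phiOf_norm φ hφ x
      rw [norm_mul, norm_mul, norm_osc, mul_one, norm_div, norm_pow, norm_mul, Complex.norm_I,
        one_mul, Complex.norm_real, Real.norm_eq_abs, Complex.norm_natCast, pk, norm_mul, norm_pow,
        Complex.norm_real, Real.norm_of_nonneg (by positivity)]
      calc |t|^k / (k.factorial : ℝ) * (‖phiOf φ x‖ * (‖phiOf φ x‖^2)^k)
          ≤ |t|^k / (k.factorial : ℝ) * (M * (M^2)^k) := by gcongr
        _ = _ := by rw [mul_pow]; ring)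
    (by
      refine Filter.Eventually.of_forall (fun x _ => ?_)
      exact (Real.summable_pow_div_factorial _).mul_left M)
    intervalIntegrable_const
    (by
      refine Filter.Eventually.of_forall (fun x _ => ?_)
      have h1 : HasSum (fun k : ℕ => (Complex.I * ((‖phiOf φ x‖^2 : ℝ) : ℂ) * (t : ℂ))^k /
          (k.factorial : ℂ)) (Complex.exp (Complex.I * ((‖phiOf φ x‖^2 : ℝ) : ℂ) * (t : ℂ))) := by
        rw [Complex.exp_eq_exp_ℂ]
        exact NormedSpace.expSeries_div_hasSum_exp _
      have h2 := (h1.mul_left (phiOf φ x)).mul_right (Complex.exp (-Complex.I * (n : ℂ) * (x : ℂ)))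
      refine hasSum_fcongr (fun k => ?_) h2
      unfold pk
      simp only [mul_pow]
      ring)
  have h2 := h.mul_left (1 / (2 * (π : ℂ)))
  unfold wCoeff
  refine hasSum_fcongr (fun k => ?_) h2
  unfold coefL
  rw [intervalIntegral.integral_const_mul]
  ring

lemma wCoeff_approx (φ : ℤ → ℂ) (hφ : (Function.support φ).Finite) (S : ℝ)
    (hS : ∀ m, ‖φ m‖ ≤ S) (n : ℤ) (t : ℝ) (ht : 0 ≤ t) (htM : t * (∑' m, ‖φ m‖)^2 ≤ 1) :
    ‖wCoeff φ n t - (φ n + Complex.I * (t *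
      ∑' p : Gam n, φ p.1.1 * (starRingEnd ℂ) (φ p.1.2.1) * φ p.1.2.2))‖
      ≤ (t^2 * (∑' m, ‖φ m‖)^4 * S) * Real.exp 1 := by
  have hs : ∀ m ∉ hφ.toFinset, φ m = 0 := fun m hm => by simpa using hm
  have hS0 : 0 ≤ S := (norm_nonneg _).trans (hS 0)
  set M := ∑' m, ‖φ m‖ with hM
  have hM0 : 0 ≤ M := tsum_nonneg (fun _ => norm_nonneg _)
  have h := (hasSum_nat_add_iff' 2).2 (wCoeff_hasSum φ hφ n t)
  have h0 : pk φ 0 = phiOf φ := by funext x; simp [pk]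
  have he : wCoeff φ n t - ∑ k ∈ Finset.range 2,
      (Complex.I * t)^k / (k.factorial : ℂ) * coefL n (pk φ k) = wCoeff φ n t - (φ n + Complex.I * (t *
      ∑' p : Gam n, φ p.1.1 * (starRingEnd ℂ) (φ p.1.2.1) * φ p.1.2.2)) := by
    rw [Finset.sum_range_succ, Finset.sum_range_one, coefL_pk_one φ hφ, h0, coefL_phi φ _ hs]
    simp
    ring
  rw [he] at h
  have hexp : HasSum (fun k : ℕ => (t^2 * M^4 * S) * ((1:ℝ)^k / (k.factorial : ℝ)))
      ((t^2 * M^4 * S) * Real.exp 1) := by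
    refine HasSum.mul_left _ ?_
    rw [Real.exp_eq_exp_ℝ]
    exact NormedSpace.expSeries_div_hasSum_exp _
  rw [← h.tsum_eq]
  refine tsum_of_norm_bounded hexp (fun k => ?_)
  rw [norm_mul, norm_div, norm_pow, norm_mul, Complex.norm_I,
        one_mul, Complex.norm_real, Real.norm_of_nonneg ht, Complex.norm_natCast]
  have hb := coefL_pk_bound φ hφ S hS (k+2) n
  have hfac : (k.factorial : ℝ) ≤ ((k+2).factorial : ℝ) := by
    exact_mod_cast Nat.factorial_le (by omega)
  have hk0 : (0:ℝ) < k.factorial := by exact_mod_cast Nat.factorial_pos k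
  calc t^(k+2) / ((k+2).factorial : ℝ) * ‖coefL n (pk φ (k+2))‖
      ≤ t^(k+2) / (k.factorial : ℝ) * (M^(2*(k+2)) * S) := by gcongr
    _ = (t^2 * M^4 * S) * ((t * M^2)^k / (k.factorial : ℝ)) := by
        rw [mul_pow, ← pow_mul]; ring
    _ ≤ _ := by gcongr

/-- Oscillating factor. -/
noncomputable def osc (n : ℤ) (p : Gam n) (t : ℝ) : ℂ :=
  Complex.exp (-Complex.I * ((n^2 - p.1.1^2 + p.1.2.1^2 - p.1.2.2^2 : ℤ) : ℂ) * (t : ℂ))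

lemma osc_norm (n : ℤ) (p : Gam n) (t : ℝ) : ‖osc n p t‖ = 1 := norm_osc _ _

lemma osc_cont (n : ℤ) (p : Gam n) : Continuous (osc n p) := by
  unfold osc; fun_prop

/-- Cubic sum. -/
noncomputable def cub (n : ℤ) (c : Gam n → ℂ) (f g h : ℤ → ℂ) : ℂ :=
  ∑' p : Gam n, c p * f p.1.1 * (starRingEnd ℂ) (g p.1.2.1) * h p.1.2.2

lemma cub1 (n : ℤ) (c : Gam n → ℂ) (f g h : ℤ → ℂ) (B A X Y : ℝ) (hB : 0 ≤ B)
    (hc : ∀ p, ‖c p‖ ≤ B) (hf : ∀ m, ‖f m‖ ≤ A)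
    (hg : Summable (fun m => ‖g m‖)) (hh : Summable (fun m => ‖h m‖))
    (hX : ∑' m, ‖g m‖ ≤ X) (hY : ∑' m, ‖h m‖ ≤ Y) :
    Summable (fun p : Gam n => c p * f p.1.1 * (starRingEnd ℂ) (g p.1.2.1) * h p.1.2.2) ∧
    ‖cub n c f g h‖ ≤ B * A * (X * Y) := by
  have hA0 : 0 ≤ A := (norm_nonneg _).trans (hf 0)
  have hX0 : 0 ≤ X := (tsum_nonneg (fun _ => norm_nonneg _)).trans hX
  have h1 := tri_bound (fun p : Gam n => (p.1.2.1, p.1.2.2)) (gam_inj23 n)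
    (fun p : Gam n => c p * f p.1.1 * (starRingEnd ℂ) (g p.1.2.1) * h p.1.2.2)
    (fun m => ‖g m‖) (fun m => ‖h m‖) (fun _ => norm_nonneg _) (fun _ => norm_nonneg _) hg hh
    (B * A) (by positivity) (fun p => by
      rw [norm_mul, norm_mul, norm_mul, RCLike.norm_conj, mul_assoc]
      have := hc p
      have := hf p.1.1
      gcongr)
  refine ⟨h1.1, h1.2.trans ?_⟩
  gcongr

lemma cub2 (n : ℤ) (c : Gam n → ℂ) (f g h : ℤ → ℂ) (B A X Y : ℝ) (hB : 0 ≤ B)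
    (hc : ∀ p, ‖c p‖ ≤ B) (hf : ∀ m, ‖g m‖ ≤ A)
    (hg : Summable (fun m => ‖f m‖)) (hh : Summable (fun m => ‖h m‖))
    (hX : ∑' m, ‖f m‖ ≤ X) (hY : ∑' m, ‖h m‖ ≤ Y) :
    Summable (fun p : Gam n => c p * f p.1.1 * (starRingEnd ℂ) (g p.1.2.1) * h p.1.2.2) ∧
    ‖cub n c f g h‖ ≤ B * A * (X * Y) := by
  have hA0 : 0 ≤ A := (norm_nonneg _).trans (hf 0)
  have hX0 : 0 ≤ X := (tsum_nonneg (fun _ => norm_nonneg _)).trans hX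
  have h1 := tri_bound (fun p : Gam n => (p.1.1, p.1.2.2)) (gam_inj13 n)
    (fun p : Gam n => c p * f p.1.1 * (starRingEnd ℂ) (g p.1.2.1) * h p.1.2.2)
    (fun m => ‖f m‖) (fun m => ‖h m‖) (fun _ => norm_nonneg _) (fun _ => norm_nonneg _) hg hh
    (B * A) (by positivity) (fun p => by
      rw [norm_mul, norm_mul, norm_mul, RCLike.norm_conj]
      have := hc p
      have := hf p.1.2.1
      calc ‖c p‖ * ‖f p.1.1‖ * ‖g p.1.2.1‖ * ‖h p.1.2.2‖
          = ‖c p‖ * ‖g p.1.2.1‖ * (‖f p.1.1‖ * ‖h p.1.2.2‖) := by ring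
        _ ≤ _ := by gcongr)
  refine ⟨h1.1, h1.2.trans ?_⟩
  gcongr

lemma cub3 (n : ℤ) (c : Gam n → ℂ) (f g h : ℤ → ℂ) (B A X Y : ℝ) (hB : 0 ≤ B)
    (hc : ∀ p, ‖c p‖ ≤ B) (hf : ∀ m, ‖h m‖ ≤ A)
    (hg : Summable (fun m => ‖f m‖)) (hh : Summable (fun m => ‖g m‖))
    (hX : ∑' m, ‖f m‖ ≤ X) (hY : ∑' m, ‖g m‖ ≤ Y) :
    Summable (fun p : Gam n => c p * f p.1.1 * (starRingEnd ℂ) (g p.1.2.1) * h p.1.2.2) ∧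
    ‖cub n c f g h‖ ≤ B * A * (X * Y) := by
  have hA0 : 0 ≤ A := (norm_nonneg _).trans (hf 0)
  have hX0 : 0 ≤ X := (tsum_nonneg (fun _ => norm_nonneg _)).trans hX
  have h1 := tri_bound (fun p : Gam n => (p.1.1, p.1.2.1)) (gam_inj12 n)
    (fun p : Gam n => c p * f p.1.1 * (starRingEnd ℂ) (g p.1.2.1) * h p.1.2.2)
    (fun m => ‖f m‖) (fun m => ‖g m‖) (fun _ => norm_nonneg _) (fun _ => norm_nonneg _) hg hh
    (B * A) (by positivity) (fun p => by
      rw [norm_mul, norm_mul, norm_mul, RCLike.norm_conj]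
      have := hc p
      have := hf p.1.2.2
      calc ‖c p‖ * ‖f p.1.1‖ * ‖g p.1.2.1‖ * ‖h p.1.2.2‖
          = ‖c p‖ * ‖h p.1.2.2‖ * (‖f p.1.1‖ * ‖g p.1.2.1‖) := by ring
        _ ≤ _ := by gcongr)
  refine ⟨h1.1, h1.2.trans ?_⟩
  gcongr

lemma cub_diff (n : ℤ) (c : Gam n → ℂ) (f φ : ℤ → ℂ) (D X : ℝ)
    (hc : ∀ p, ‖c p‖ ≤ 1) (hD : ∀ m, ‖f m - φ m‖ ≤ D)
    (hf : Summable (fun m => ‖f m‖)) (hφ : Summable (fun m => ‖φ m‖))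
    (hX : ∑' m, ‖f m‖ ≤ X) (hY : ∑' m, ‖φ m‖ ≤ X) :
    ‖cub n c f f f - cub n c φ φ φ‖ ≤ 3 * D * X^2 := by
  have h1 := cub1 n c (fun m => f m - φ m) f f 1 D X X zero_le_one hc hD hf hf hX hX
  have h2 := cub2 n c φ (fun m => f m - φ m) f 1 D X X zero_le_one hc hD hφ hf hY hX
  have h3 := cub3 n c φ φ (fun m => f m - φ m) 1 D X X zero_le_one hc hD hφ hφ hY hY
  have hφb : ∀ m, ‖φ m‖ ≤ X := fun m => (hφ.le_tsum m (fun _ _ => norm_nonneg _)).trans hY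
  have hfb : ∀ m, ‖f m‖ ≤ X := fun m => (hf.le_tsum m (fun _ _ => norm_nonneg _)).trans hX
  have h4 := (cub1 n c f f f 1 X X X zero_le_one hc hfb hf hf hX hX).1
  have h5 := (cub1 n c φ φ φ 1 X X X zero_le_one hc hφb hφ hφ hY hY).1
  have he : cub n c f f f - cub n c φ φ φ = cub n c (fun m => f m - φ m) f f +
      cub n c φ (fun m => f m - φ m) f + cub n c φ φ (fun m => f m - φ m) := by
    unfold cub
    rw [← h4.tsum_sub h5, ← h1.1.tsum_add h2.1, ← (h1.1.add h2.1).tsum_add h3.1]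
    refine tsum_congr (fun p => ?_)
    simp only [map_sub]
    ring
  rw [he]
  refine (norm_add₃_le).trans ?_
  have := h1.2
  have := h2.2
  have := h3.2
  nlinarith

lemma cub_phi_fin (φ : ℤ → ℂ) (hφ : (Function.support φ).Finite) (n : ℤ) :
    ∃ s : Finset (Gam n), ∀ c : Gam n → ℂ, cub n c φ φ φ =
      ∑ p ∈ s, c p * (φ p.1.1 * (starRingEnd ℂ) (φ p.1.2.1) * φ p.1.2.2) := by
  obtain ⟨s, hs⟩ := gam_fin φ hφ n
  refine ⟨s, fun c => ?_⟩
  unfold cub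
  rw [tsum_eq_sum (s := s)]
  · exact Finset.sum_congr rfl (fun p _ => by ring)
  · intro p hp
    rcases hs p hp with h | h <;> simp [h]

lemma cub_phi_cont (φ : ℤ → ℂ) (hφ : (Function.support φ).Finite) (n : ℤ) :
    Continuous (fun t => cub n (fun p => osc n p t) φ φ φ) := by
  obtain ⟨s, hs⟩ := cub_phi_fin φ hφ n
  simp only [hs]
  have := osc_cont n
  fun_prop

lemma cub_phi_id (φ : ℤ → ℂ) (hφ : (Function.support φ).Finite) (n : ℤ) (t : ℝ) :
    (t : ℂ) * cub n (fun _ => 1) φ φ φ - ∫ t' in (0:ℝ)..t, cub n (fun p => osc n p t') φ φ φ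
      = cub n (fun p => ∫ t' in (0:ℝ)..t, (1 - osc n p t')) φ φ φ := by
  obtain ⟨s, hs⟩ := cub_phi_fin φ hφ n
  simp only [hs]
  have ho := osc_cont n
  rw [intervalIntegral.integral_finsetSum, Finset.mul_sum, ← Finset.sum_sub_distrib]
  · refine Finset.sum_congr rfl (fun p _ => ?_)
    rw [intervalIntegral.integral_mul_const, intervalIntegral.integral_sub
      intervalIntegrable_const ((ho p).intervalIntegrable _ _)]
    simp
    ring
  · intro p _
    exact Continuous.intervalIntegrable (by fun_prop) _ _

lemma a_approx (K : ℝ) (hK : 1 ≤ K) (φ : ℤ → ℂ) (hφ : (Function.support φ).Finite) (T S M : ℝ)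
    (hT : 0 < T) (hM : M = ∑' n, ‖φ n‖) (hS : ∀ m, ‖φ m‖ ≤ S) (a : ℤ → ℝ → ℂ)
    (ha : ∀ n, ∀ t ∈ Set.Icc (0:ℝ) T, a n t = φ n + Complex.I *
      ∫ t' in (0:ℝ)..t, cub n (fun p => osc n p t') (fun m => a m t') (fun m => a m t') (fun m => a m t'))
    (hs : ∀ t ∈ Set.Icc (0:ℝ) T, Summable (fun n : ℤ => ‖a n t‖))
    (h1 : ∀ t ∈ Set.Icc (0:ℝ) T, (∑' n : ℤ, ‖a n t‖) ≤ K * M)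
    (hi : ∀ t ∈ Set.Icc (0:ℝ) T, ∀ n : ℤ, ‖a n t‖ ≤ K * S)
    (t : ℝ) (ht : t ∈ Set.Icc (0:ℝ) T) (n : ℤ) :
    ‖a n t - (φ n + Complex.I * ∫ t' in (0:ℝ)..t, cub n (fun p => osc n p t') φ φ φ)‖ ≤
      3 * K^5 * (T^2 * M^4 * S) := by
  have hM0 : 0 ≤ M := hM ▸ tsum_nonneg (fun _ => norm_nonneg _)
  have hS0 : 0 ≤ S := (norm_nonneg _).trans (hS 0)
  have hK0 : 0 ≤ K := zero_le_one.trans hK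
  have hφs := summable_of_finite_supp φ hφ
  have hφM : ∑' n, ‖φ n‖ ≤ K * M := by rw [← hM]; nlinarith
  set Q : ℤ → ℝ → ℂ := fun n t' =>
    cub n (fun p => osc n p t') (fun m => a m t') (fun m => a m t') (fun m => a m t') with hQ
  have hc : ∀ n (t' : ℝ) (p : Gam n), ‖osc n p t'‖ ≤ 1 := fun n t' p => (osc_norm n p t').le
  have hQs : ∀ n, ∀ t' ∈ Set.Icc (0:ℝ) T, _ := fun n t' ht' =>
    cub1 n (fun p => osc n p t') (fun m => a m t') (fun m => a m t') (fun m => a m t') 1 (K * S)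
      (K * M) (K * M) zero_le_one (hc n t') (hi t' ht') (hs t' ht') (hs t' ht') (h1 t' ht') (h1 t' ht')
  have hQb : ∀ n, ∀ t' ∈ Set.Icc (0:ℝ) T, ‖Q n t'‖ ≤ K^3 * M^2 * S := fun n t' ht' =>
    (hQs n t' ht').2.trans (le_of_eq (by ring))
  have ham : ∀ n, AEMeasurable (a n) (MeasureTheory.volume.restrict (Set.Icc 0 T)) := by
    intro n
    have := aemeas_prim T _ (Q n) (hQb n)
    refine AEMeasurable.congr ((this.const_mul Complex.I).const_add (φ n)) ?_
    filter_upwards [MeasureTheory.ae_restrict_mem measurableSet_Icc] with t ht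
    exact (ha n t ht).symm
  have hQm : ∀ n, AEMeasurable (Q n) (MeasureTheory.volume.restrict (Set.Icc 0 T)) := by
    intro n
    refine aemeas_tsum _ _ (fun p => ?_) ?_
    · refine ((((osc_cont n p).aemeasurable).mul (ham _)).mul ?_).mul (ham _)
      exact Complex.continuous_conj.measurable.comp_aemeasurable (ham _)
    · filter_upwards [MeasureTheory.ae_restrict_mem measurableSet_Icc] with t ht
      exact (hQs n t ht).1
  have hsub : ∀ t ∈ Set.Icc (0:ℝ) T, Set.uIoc 0 t ⊆ Set.Icc 0 T := by
    intro t ht x hx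
    rw [Set.uIoc_of_le ht.1] at hx
    exact ⟨hx.1.le, hx.2.trans ht.2⟩
  have hQi : ∀ n, ∀ t ∈ Set.Icc (0:ℝ) T, IntervalIntegrable (Q n) MeasureTheory.volume 0 t := by
    intro n t ht
    have : MeasureTheory.IntegrableOn (Q n) (Set.Icc 0 T) := by
      refine MeasureTheory.Integrable.of_bound
        (hQm n).aestronglyMeasurable (K^3 * M^2 * S) ?_
      filter_upwards [MeasureTheory.ae_restrict_mem measurableSet_Icc] with t ht
      exact hQb n t ht
    rw [intervalIntegrable_iff]
    exact this.mono_set (hsub t ht)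
  have hd : ∀ t ∈ Set.Icc (0:ℝ) T, ∀ m, ‖a m t - φ m‖ ≤ K^3 * M^2 * S * T := by
    intro t ht m
    rw [ha m t ht, add_sub_cancel_left, norm_mul, Complex.norm_I, one_mul]
    refine (intervalIntegral.norm_integral_le_of_norm_le_const
      (fun x hx => hQb m x (hsub t ht hx))).trans ?_
    rw [sub_zero, abs_of_nonneg ht.1]
    have := ht.2
    gcongr
  have he : a n t - (φ n + Complex.I * ∫ t' in (0:ℝ)..t, cub n (fun p => osc n p t') φ φ φ) =
      Complex.I * ∫ t' in (0:ℝ)..t, (Q n t' - cub n (fun p => osc n p t') φ φ φ) := by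
    rw [intervalIntegral.integral_sub (hQi n t ht) ((cub_phi_cont φ hφ n).intervalIntegrable _ _),
      ha n t ht]
    ring
  rw [he, norm_mul, Complex.norm_I, one_mul]
  refine (intervalIntegral.norm_integral_le_of_norm_le_const
    (C := 3 * (K^3 * M^2 * S * T) * (K * M)^2)
    (fun x hx => ?_)).trans ?_
  · have hx' := hsub t ht hx
    exact cub_diff n _ _ φ _ _ (hc n x) (hd x hx') (hs x hx') hφs (h1 x hx') hφM
  · rw [sub_zero, abs_of_nonneg ht.1]
    have := ht.2
    calc _ ≤ 3 * (K^3 * M^2 * S * T) * (K * M)^2 * T := by gcongr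
      _ = _ := by ring

/-- Approximation of solutions of the Duhamel system of the interaction
representation of the cubic NLS on the circle by the dispersionless ODE. -/
theorem duhamel_ode_approximation (K : ℝ) (hK : 1 ≤ K) :
    ∃ C : ℝ, 0 < C ∧
      ∀ (φhat : ℤ → ℂ), (Function.support φhat).Finite →
      ∀ T : ℝ, 0 < T → T * (∑' n : ℤ, ‖φhat n‖)^2 ≤ 1 →
      ∀ a : ℤ → ℝ → ℂ,
        -- Duhamel system with data `φ̂`
        (∀ (n : ℤ), ∀ t ∈ Set.Icc (0:ℝ) T,
          a n t = φhat n + Complex.I *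
            ∫ t' in (0:ℝ)..t,
              ∑' p : {p : ℤ × ℤ × ℤ // n = p.1 - p.2.1 + p.2.2},
                Complex.exp (-Complex.I *
                    ((n^2 - p.1.1^2 + p.1.2.1^2 - p.1.2.2^2 : ℤ) : ℂ) * (t' : ℂ)) *
                  a p.1.1 t' * (starRingEnd ℂ) (a p.1.2.1 t') * a p.1.2.2 t') →
        -- a priori bounds
        (∀ t ∈ Set.Icc (0:ℝ) T, Summable (fun n : ℤ => ‖a n t‖)) →
        (∀ t ∈ Set.Icc (0:ℝ) T,
          (∑' n : ℤ, ‖a n t‖) ≤ K * ∑' n : ℤ, ‖φhat n‖) →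
        (∀ t ∈ Set.Icc (0:ℝ) T, ∀ n : ℤ,
          ‖a n t‖ ≤ K * ⨆ m : ℤ, ‖φhat m‖) →
        -- conclusion
        ∀ t ∈ Set.Icc (0:ℝ) T, ∀ n : ℤ,
          ‖wCoeff φhat n t - a n t‖ ≤
            C * ((⨆ τ : Set.Icc (0:ℝ) T, ⨆ m : ℤ,
                ‖∑' p : {p : ℤ × ℤ × ℤ // m = p.1 - p.2.1 + p.2.2},
                  (∫ t' in (0:ℝ)..(τ:ℝ),
                    (1 - Complex.exp (-Complex.I *
                      ((m^2 - p.1.1^2 + p.1.2.1^2 - p.1.2.2^2 : ℤ) : ℂ) * (t' : ℂ)))) *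
                    φhat p.1.1 * (starRingEnd ℂ) (φhat p.1.2.1) * φhat p.1.2.2‖)
              + ∑ k ∈ Finset.Icc 2 4,
                  T^k * (∑' n : ℤ, ‖φhat n‖)^(2*k) * ⨆ m : ℤ, ‖φhat m‖) := by
  refine ⟨3 * K^5 + Real.exp 1, by positivity, ?_⟩
  intro φ hφ T hT hTM a ha hs h1 hi t ht n
  set M := ∑' n : ℤ, ‖φ n‖ with hM
  set S := ⨆ m : ℤ, ‖φ m‖ with hSdef
  have hφs := summable_of_finite_supp φ hφ
  have hM0 : 0 ≤ M := tsum_nonneg (fun _ => norm_nonneg _)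
  have hbd : BddAbove (Set.range fun m : ℤ => ‖φ m‖) := by
    refine ⟨M, ?_⟩
    rintro _ ⟨m, rfl⟩
    exact hφs.le_tsum m (fun _ _ => norm_nonneg _)
  have hS : ∀ m, ‖φ m‖ ≤ S := fun m => le_ciSup hbd m
  have hS0 : 0 ≤ S := (norm_nonneg _).trans (hS 0)
  have hA := a_approx K hK φ hφ T S M hT hM hS a ha hs h1 hi t ht n
  have hW := wCoeff_approx φ hφ S hS n t ht.1
    ((mul_le_mul_of_nonneg_right ht.2 (sq_nonneg _)).trans hTM)
  have hone : (∑' p : Gam n, φ p.1.1 * (starRingEnd ℂ) (φ p.1.2.1) * φ p.1.2.2) =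
      cub n (fun _ => 1) φ φ φ := by
    unfold cub; simp only [one_mul]
  rw [hone, ← hM] at hW
  set R : ℝ → ℤ → ℝ := fun τ m =>
    ‖cub m (fun p => ∫ t' in (0:ℝ)..τ, (1 - osc m p t')) φ φ φ‖ with hR
  have hRb : ∀ (τ : Set.Icc (0:ℝ) T) (m : ℤ), R τ m ≤ (2 * T) * S * (M * M) := by
    intro τ m
    refine (cub1 m _ φ φ φ (2 * T) S M M (by positivity) (fun p => ?_) hS hφs hφs le_rfl le_rfl).2
    refine (intervalIntegral.norm_integral_le_of_norm_le_const (C := 2) (fun x _ => ?_)).trans ?_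
    · refine (norm_sub_le _ _).trans ?_
      rw [osc_norm, norm_one]; norm_num
    · rw [sub_zero, abs_of_nonneg τ.2.1]
      have := τ.2.2
      gcongr
  have hRsup : R t n ≤ ⨆ τ : Set.Icc (0:ℝ) T, ⨆ m : ℤ, R τ m := by
    have hb1 : BddAbove (Set.range fun m : ℤ => R t m) :=
      ⟨_, by rintro _ ⟨m, rfl⟩; exact hRb ⟨t, ht⟩ m⟩
    have hb2 : BddAbove (Set.range fun τ : Set.Icc (0:ℝ) T => ⨆ m : ℤ, R τ m) :=
      ⟨_, by rintro _ ⟨τ, rfl⟩; exact ciSup_le (fun m => hRb τ m)⟩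
    exact (le_ciSup hb1 n).trans (le_ciSup hb2 (⟨t, ht⟩ : Set.Icc (0:ℝ) T))
  have hid := cub_phi_id φ hφ n t
  have hmain : ‖wCoeff φ n t - a n t‖ ≤
      R t n + (T^2 * M^4 * S) * Real.exp 1 + 3 * K^5 * (T^2 * M^4 * S) := by
    have he : wCoeff φ n t - a n t =
        Complex.I * cub n (fun p => ∫ t' in (0:ℝ)..t, (1 - osc n p t')) φ φ φ
        + (wCoeff φ n t - (φ n + Complex.I * (t * cub n (fun _ => 1) φ φ φ)))
        - (a n t - (φ n + Complex.I * ∫ t' in (0:ℝ)..t, cub n (fun p => osc n p t') φ φ φ)) := by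
      rw [← hid]; ring
    rw [he]
    refine (norm_sub_le _ _).trans (add_le_add ((norm_add_le _ _).trans (add_le_add ?_ ?_)) hA)
    · rw [norm_mul, Complex.norm_I, one_mul]
    · refine hW.trans ?_
      have := ht.1
      have := ht.2
      gcongr
  have hsum : T^2 * M^4 * S ≤ ∑ k ∈ Finset.Icc 2 4, T^k * M^(2*k) * S := by
    have := Finset.single_le_sum (s := Finset.Icc 2 4) (f := fun k : ℕ => T^k * M^(2*k) * S)
      (fun k _ => by positivity) (show 2 ∈ Finset.Icc 2 4 by simp)
    simpa using this
  change _ ≤ _ * ((⨆ τ : Set.Icc (0:ℝ) T, ⨆ m : ℤ, R τ m) + _)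
  have hC1 : 1 ≤ 3 * K^5 + Real.exp 1 := by
    have : 1 ≤ K^5 := one_le_pow₀ hK
    have := Real.exp_pos 1
    linarith
  have hR0 : 0 ≤ R t n := norm_nonneg _
  calc _ ≤ R t n + (T^2 * M^4 * S) * Real.exp 1 + 3 * K^5 * (T^2 * M^4 * S) := hmain
    _ = R t n + (3 * K^5 + Real.exp 1) * (T^2 * M^4 * S) := by ring
    _ ≤ (3 * K^5 + Real.exp 1) * R t n + (3 * K^5 + Real.exp 1) * (T^2 * M^4 * S) := by
        gcongr; exact le_mul_of_one_le_left hR0 hC1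
    _ = (3 * K^5 + Real.exp 1) * (R t n + T^2 * M^4 * S) := by ring
    _ ≤ _ := by gcongr
end

section
/- Let s ≤ −1/2. Suppose ψ : ℝ → ℂ is continuous with compact support, satisfies ∫_ℝ |ξ|^{2s} |ψ̂(ξ)|² dξ < ∞, ψ̂(ξ) = O(|ξ|^κ) as ξ → 0 for some κ > −s − 1/2, and |∫_ℝ ψ(x) e^{i|ψ(x)|² t₀} dx| ≥ c for some t₀ > 0 and c > 0. Then there exists φ ∈ C_c^∞(ℝ) such that ∫_ℝ |ξ|^{2s} |φ̂(ξ)|² dξ < ∞, φ̂(ξ) = O(|ξ|^{κ'}) as ξ → 0 for some κ' > −s − 1/2, and |∫_ℝ φ(x) e^{i|φ(x)|² t₀} dx| ≥ c/2. -/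
open scoped Real

/-- Fourier transform on `ℝ`: `f̂(ξ) = ∫_ℝ f(x) e^{−2πixξ} dx`. -/
noncomputable def fourierInt (f : ℝ → ℂ) (ξ : ℝ) : ℂ :=
  ∫ x : ℝ, f x * Complex.exp (-2 * (π : ℂ) * Complex.I * (x : ℂ) * (ξ : ℂ))

open MeasureTheory Filter Topology Convolution FourierTransform in
theorem fourierInt_eq_fourier (f : ℝ → ℂ) (ξ : ℝ) : fourierInt f ξ = 𝓕 f ξ := by
  rw [Real.fourier_real_eq_integral_exp_smul]
  unfold fourierInt
  congr 1
  ext x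
  rw [smul_eq_mul, mul_comm]
  congr 2
  push_cast
  ring

open MeasureTheory Filter Topology Convolution FourierTransform in
theorem continuous_fourierInt (f : ℝ → ℂ) (hf : Integrable f) : Continuous (fourierInt f) := by
  have h : fourierInt f = 𝓕 f := funext (fourierInt_eq_fourier f)
  rw [h]
  exact VectorFourier.fourierIntegral_continuous Real.continuous_fourierChar
    (by exact continuous_inner) hf

open MeasureTheory Filter Topology Convolution FourierTransform in
theorem norm_fourierInt_mollify_le (ρ : ContDiffBump (0 : ℝ)) (ψ : ℝ → ℂ) (hψ : Integrable ψ)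
    (ξ : ℝ) :
    ‖fourierInt (ρ.normed volume ⋆[ContinuousLinearMap.lsmul ℝ ℝ, volume] ψ) ξ‖
      ≤ ‖fourierInt ψ ξ‖ := by
  have h1 : (ρ.normed volume ⋆[ContinuousLinearMap.lsmul ℝ ℝ, volume] ψ)
      = ((fun x => ((ρ.normed volume x : ℝ) : ℂ)) ⋆[ContinuousLinearMap.lsmul ℂ ℂ, volume] ψ) := by
    ext x
    simp [convolution_def]
  have hi : Integrable (fun x => ((ρ.normed volume x : ℝ) : ℂ)) := ρ.integrable_normed.ofReal
  rw [h1, fourierInt_eq_fourier, fourierInt_eq_fourier, Real.fourier_smul_convolution_eq hi hψ,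
    norm_smul]
  have h2 : ‖𝓕 (fun x => ((ρ.normed volume x : ℝ) : ℂ)) ξ‖ ≤ 1 := by
    refine (VectorFourier.norm_fourierIntegral_le_integral_norm _ _ _ _ _).trans ?_
    simp only [Complex.norm_real, Real.norm_eq_abs, abs_of_nonneg (ρ.nonneg_normed _)]
    exact ρ.integral_normed.le
  exact mul_le_of_le_one_left (norm_nonneg _) h2

open MeasureTheory Filter Topology Convolution in
/-- A continuous compactly supported datum exhibiting high-to-low energy
transfer for the dispersionless ODE can be replaced by a smooth compactly
supported one, keeping the `Ḣ^s` finiteness, the vanishing of `f̂` at `0`,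
and (half of) the mean lower bound at time `t₀`. -/
theorem smoothing_of_ode_datum (s : ℝ) (hs : s ≤ -(1/2))
    (ψ : ℝ → ℂ) (hψc : Continuous ψ) (hψsupp : HasCompactSupport ψ)
    (hψint : MeasureTheory.Integrable (fun ξ : ℝ => |ξ| ^ (2*s) * ‖fourierInt ψ ξ‖^2))
    (κ : ℝ) (hκ : -s - 1/2 < κ)
    (hO : Asymptotics.IsBigO (nhds (0:ℝ)) (fun ξ : ℝ => fourierInt ψ ξ)
      (fun ξ : ℝ => |ξ| ^ κ))
    (t₀ c : ℝ) (ht₀ : 0 < t₀) (hc : 0 < c)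
    (hmean : c ≤ ‖∫ x : ℝ, ψ x *
      Complex.exp (Complex.I * ((‖ψ x‖^2 : ℝ) : ℂ) * (t₀ : ℂ))‖) :
    ∃ φ : ℝ → ℂ, ContDiff ℝ (⊤ : ℕ∞) φ ∧ HasCompactSupport φ ∧
      MeasureTheory.Integrable (fun ξ : ℝ => |ξ| ^ (2*s) * ‖fourierInt φ ξ‖^2) ∧
      (∃ κ' : ℝ, -s - 1/2 < κ' ∧
        Asymptotics.IsBigO (nhds (0:ℝ)) (fun ξ : ℝ => fourierInt φ ξ)
          (fun ξ : ℝ => |ξ| ^ κ')) ∧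
      c/2 ≤ ‖∫ x : ℝ, φ x *
        Complex.exp (Complex.I * ((‖φ x‖^2 : ℝ) : ℂ) * (t₀ : ℂ))‖ := by
  classical
  have hψi : Integrable ψ := hψc.integrable_of_hasCompactSupport hψsupp
  obtain ⟨M, hM⟩ := hψsupp.exists_bound_of_continuous hψc
  have hM0 : 0 ≤ M := (norm_nonneg _).trans (hM 0)
  obtain ⟨R, hR⟩ := hψsupp.isCompact.isBounded.subset_closedBall (0 : ℝ)
  let ρ : ℕ → ContDiffBump (0 : ℝ) := fun n =>
    ⟨1 / ((n : ℝ) + 1) / 2, 1 / ((n : ℝ) + 1), by positivity,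
      half_lt_self (by positivity)⟩
  have hρ1 : ∀ n, (ρ n).rOut ≤ 1 := fun n => by
    change 1 / ((n : ℝ) + 1) ≤ 1
    rw [div_le_one (by positivity)]
    linarith [Nat.cast_nonneg (α := ℝ) n]
  have hρ0 : Tendsto (fun n => (ρ n).rOut) atTop (𝓝 0) :=
    tendsto_one_div_add_atTop_nhds_zero_nat
  let φ : ℕ → ℝ → ℂ := fun n =>
    ((ρ n).normed volume ⋆[ContinuousLinearMap.lsmul ℝ ℝ, volume] ψ)
  have hsm : ∀ n, ContDiff ℝ (⊤ : ℕ∞) (φ n) := fun n =>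
    (ρ n).hasCompactSupport_normed.contDiff_convolution_left _ (ρ n).contDiff_normed
      hψi.locallyIntegrable
  have hcs : ∀ n, HasCompactSupport (φ n) := fun n =>
    (ρ n).hasCompactSupport_normed.convolution _ hψsupp
  have hlim : ∀ x, Tendsto (fun n => φ n x) atTop (𝓝 (ψ x)) := fun x =>
    ContDiffBump.convolution_tendsto_right_of_continuous hρ0 hψc x
  have hbd : ∀ n x, ‖φ n x‖ ≤ 3 * M := fun n x => by
    have h : dist (φ n x) (ψ x) ≤ 2 * M :=
      ContDiffBump.dist_normed_convolution_le hψc.aestronglyMeasurable (fun y _ => by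
        rw [dist_eq_norm]
        linarith [norm_sub_le (ψ y) (ψ x), hM y, hM x])
    rw [dist_eq_norm] at h
    have h2 := norm_add_le (φ n x - ψ x) (ψ x)
    rw [sub_add_cancel] at h2
    linarith [hM x]
  have hzero : ∀ n x, x ∉ Metric.closedBall (0 : ℝ) (R + 1) → φ n x = 0 := fun n x hx => by
    have hψ0 : ∀ y, R < |y| → ψ y = 0 := fun y hy => by
      apply image_eq_zero_of_notMem_tsupport
      intro h
      have := hR h
      simp at this
      linarith
    have hx' : R + 1 < |x| := by simpa using hx
    have h0 : ψ x = 0 := hψ0 x (by linarith)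
    have : φ n x = ψ x := ContDiffBump.normed_convolution_eq_right (fun y hy => by
      rw [h0]
      apply hψ0
      rw [Metric.mem_ball, Real.dist_eq] at hy
      have := abs_sub_abs_le_abs_sub x y
      rw [abs_sub_comm] at this
      linarith [hρ1 n])
    rw [this, h0]
  have hnorm : ∀ z : ℂ, ‖z * Complex.exp (Complex.I * ((‖z‖^2 : ℝ) : ℂ) * (t₀ : ℂ))‖ = ‖z‖ := by
    intro z
    have : Complex.I * ((‖z‖^2 : ℝ) : ℂ) * (t₀ : ℂ) = ((‖z‖^2 * t₀ : ℝ) : ℂ) * Complex.I := by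
      push_cast
      ring
    rw [norm_mul, this, Complex.norm_exp_ofReal_mul_I, mul_one]
  have hGc : Continuous
      (fun z : ℂ => z * Complex.exp (Complex.I * ((‖z‖^2 : ℝ) : ℂ) * (t₀ : ℂ))) := by
    fun_prop
  have hconv : Tendsto (fun n => ∫ x : ℝ, φ n x *
      Complex.exp (Complex.I * ((‖φ n x‖^2 : ℝ) : ℂ) * (t₀ : ℂ))) atTop
      (𝓝 (∫ x : ℝ, ψ x * Complex.exp (Complex.I * ((‖ψ x‖^2 : ℝ) : ℂ) * (t₀ : ℂ)))) := by
    refine tendsto_integral_of_dominated_convergence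
      ((Metric.closedBall (0 : ℝ) (R + 1)).indicator (fun _ => 3 * M)) ?_ ?_ ?_ ?_
    · exact fun n => (hGc.comp (hsm n).continuous).aestronglyMeasurable
    · rw [integrable_indicator_iff measurableSet_closedBall]
      exact continuous_const.continuousOn.integrableOn_compact (isCompact_closedBall _ _)
    · intro n
      refine Eventually.of_forall fun x => ?_
      rw [hnorm]
      by_cases hx : x ∈ Metric.closedBall (0 : ℝ) (R + 1)
      · rw [Set.indicator_of_mem hx]
        exact hbd n x
      · rw [Set.indicator_of_notMem hx, hzero n x hx, norm_zero]
    · exact Eventually.of_forall fun x => (hGc.tendsto _).comp (hlim x)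
  have hev := hconv.norm.eventually (lt_mem_nhds (show c / 2 < _ by linarith))
  obtain ⟨n, hn⟩ := hev.exists
  have hle : ∀ ξ, ‖fourierInt (φ n) ξ‖ ≤ ‖fourierInt ψ ξ‖ :=
    norm_fourierInt_mollify_le (ρ n) ψ hψi
  refine ⟨φ n, hsm n, hcs n, ?_, ⟨κ, hκ, ?_⟩, hn.le⟩
  · refine hψint.mono' ?_ (Eventually.of_forall fun ξ => ?_)
    · have hc1 := continuous_fourierInt (φ n)
        ((hsm n).continuous.integrable_of_hasCompactSupport (hcs n))
      exact Measurable.aestronglyMeasurable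
        ((measurable_id.abs.pow_const _).mul (hc1.norm.pow 2).measurable)
    · rw [Real.norm_of_nonneg (by positivity)]
      have := hle ξ
      gcongr
  · exact (Asymptotics.IsBigO.of_norm_le hle).trans hO.norm_left
end
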